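/- Let F be a field complete with respect to a nonarchimedean absolute value extending the p-adic absolute value, and let 𝔪 = {x ∈ F : |x| < 1}. The logarithm log : 1 + 𝔪 → F, log(1+x) = Σ_{n≥1} (−1)^{n+1} x^n/n, converges for all x ∈ 𝔪 with |x| < |p|^{1/(p−1)} and defines a group homomorphism from the multiplicative group 1 + 𝔪' to (F, +) on the subgroup 1 + 𝔪' where 𝔪' = {x : |x| < |p|^{1/(p−1)}}, and on this subgroup it is injective with inverse given by the exponential series. -/

import Mathlib

open scoped BigOperators

noncomputable section

/-- `log(1+x)` as the series `∑_{n ≥ 1} (−1)^{n+1} x^n / n` (the `n = 0` term vanishes since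
`1/0 = 0` in a field). -/
def pLog {F : Type*} [NontriviallyNormedField F] (x : F) : F :=
  ∑' n : ℕ, (-1 : F) ^ (n + 1) * x ^ n / (n : F)

/-- The exponential series `∑_n x^n / n!`. -/
def pExp {F : Type*} [NontriviallyNormedField F] (x : F) : F :=
  ∑' n : ℕ, x ^ n / (n.factorial : F)

open Filter Topology

section PadicExponentialLogarithm

variable {F : Type*} [NontriviallyNormedField F]

/-- The factorial estimate which makes the exponential and logarithm series geometrically
dominated on the open ball of radius `r`. -/
def FactorialBound (F : Type*) [NontriviallyNormedField F] (r : ℝ) : Prop :=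
  ∀ n : ℕ, r ^ n ≤ ‖((n + 1).factorial : F)‖

theorem padic_norm_natCast {p : ℕ} [Fact p.Prime] {n : ℕ} (hn : n ≠ 0) :
    ‖(n : ℚ_[p])‖ = (p : ℝ) ^ (-(padicValNat p n : ℝ)) := by
  rw [Padic.norm_eq_zpow_neg_valuation (by exact_mod_cast hn), Padic.valuation_natCast,
    ← Real.rpow_intCast]
  simp

theorem factorialBound_of_norm_ratCast {p : ℕ} [Fact p.Prime]
    (hnorm : ∀ q : ℚ, ‖(q : F)‖ = ‖(q : ℚ_[p])‖) :
    FactorialBound F (‖(p : F)‖ ^ ((1 : ℝ) / ((p : ℝ) - 1))) := by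
  intro n
  have hp : 1 < (p : ℝ) := by exact_mod_cast (Fact.out : p.Prime).one_lt
  have hnat (m : ℕ) : ‖(m : F)‖ = ‖(m : ℚ_[p])‖ := by simpa using hnorm m
  rw [hnat, hnat, padic_norm_natCast (Nat.factorial_ne_zero _), Padic.norm_p,
    ← Real.rpow_neg_one, ← Real.rpow_mul (by linarith), ← Real.rpow_natCast,
    ← Real.rpow_mul (by linarith)]
  apply Real.rpow_le_rpow_of_exponent_le hp.le
  have hlt := sub_one_mul_padicValNat_factorial_lt_of_ne_zero p (Nat.succ_ne_zero n)
  have hle : (p - 1) * padicValNat p (n + 1).factorial ≤ n := Nat.lt_succ_iff.mp hlt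
  have hle' : ((p : ℝ) - 1) * padicValNat p (n + 1).factorial ≤ n := by
    rw [← Nat.cast_pred (Fact.out : p.Prime).pos]
    exact_mod_cast hle
  have hdiv : (padicValNat p (n + 1).factorial : ℝ) ≤ n / ((p : ℝ) - 1) := by
    rw [le_div_iff₀ (by linarith)]
    linarith
  calc -1 * (1 / ((p : ℝ) - 1)) * n = -(n / ((p : ℝ) - 1)) := by ring
    _ ≤ _ := neg_le_neg hdiv

theorem summable_norm_mul_geometric {r : ℝ} {x : F} (hx : ‖x‖ < r) :
    Summable fun n : ℕ => ‖x‖ * (‖x‖ / r) ^ n := by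
  have h0 : 0 < r := (norm_nonneg x).trans_lt hx
  exact (summable_geometric_of_lt_one (by positivity) ((div_lt_one h0).2 hx)).mul_left _

theorem norm_mul_geometric_le {r : ℝ} {x : F} (hx : ‖x‖ < r) (n : ℕ) :
    ‖x‖ * (‖x‖ / r) ^ n ≤ ‖x‖ := by
  have h0 : 0 < r := (norm_nonneg x).trans_lt hx
  exact mul_le_of_le_one_right (norm_nonneg x)
    (pow_le_one₀ (by positivity) ((div_lt_one h0).2 hx).le)

theorem norm_natCast_mul_le [IsUltrametricDist F] (x : F) (n : ℕ) : ‖(n : F) * x‖ ≤ ‖x‖ := by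
  rw [norm_mul]
  exact mul_le_of_le_one_left (norm_nonneg x) (IsUltrametricDist.norm_natCast_le_one F n)

namespace FactorialBound

variable {r : ℝ} (hr : FactorialBound F r)
include hr

theorem charZero (h0 : 0 < r) : CharZero F := by
  refine charZero_of_inj_zero fun n hn => ?_
  cases n with
  | zero => rfl
  | succ n =>
    have h := (pow_pos h0 n).trans_le (hr n)
    rw [Nat.factorial_succ, Nat.cast_mul, hn, zero_mul, norm_zero] at h
    exact (lt_irrefl _ h).elim

variable {x y : F}

theorem le_one [IsUltrametricDist F] : r ≤ 1 := by
  simpa using (hr 1).trans (IsUltrametricDist.norm_natCast_le_one F _)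

theorem norm_mul_lt [IsUltrametricDist F] (hx : ‖x‖ < r) (hy : ‖y‖ < r) : ‖x * y‖ < r := by
  rw [norm_mul]
  exact (mul_le_of_le_one_right (norm_nonneg x) (hy.le.trans hr.le_one)).trans_lt hx

theorem norm_div_factorial_le (hx : ‖x‖ < r) (n : ℕ) :
    ‖x ^ (n + 1) / ((n + 1).factorial : F)‖ ≤ ‖x‖ * (‖x‖ / r) ^ n := by
  have h0 : 0 < r := (norm_nonneg x).trans_lt hx
  rw [norm_div, norm_pow, pow_succ', div_pow, ← mul_div_assoc]
  exact div_le_div_of_nonneg_left (by positivity) (pow_pos h0 n) (hr n)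

theorem norm_div_succ_le [IsUltrametricDist F] (hx : ‖x‖ < r) (n : ℕ) :
    ‖x ^ (n + 1) / ((n + 1 : ℕ) : F)‖ ≤ ‖x‖ * (‖x‖ / r) ^ n := by
  have := hr.charZero ((norm_nonneg x).trans_lt hx)
  refine le_trans ?_ (hr.norm_div_factorial_le hx n)
  rw [norm_div, norm_div]
  refine div_le_div_of_nonneg_left (norm_nonneg _)
    (norm_pos_iff.2 (by exact_mod_cast Nat.factorial_ne_zero _)) ?_
  rw [Nat.factorial_succ, Nat.cast_mul, mul_comm]
  exact norm_natCast_mul_le _ _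

theorem summable_norm_exp (hx : ‖x‖ < r) :
    Summable fun n : ℕ => ‖x ^ n / (n.factorial : F)‖ := by
  rw [← summable_nat_add_iff 1]
  exact Summable.of_nonneg_of_le (fun _ => norm_nonneg _) (hr.norm_div_factorial_le hx)
    (summable_norm_mul_geometric hx)

variable [CompleteSpace F]

theorem pExp_eq (hx : ‖x‖ < r) :
    pExp x = 1 + ∑' n : ℕ, x ^ (n + 1) / ((n + 1).factorial : F) := by
  rw [pExp, (hr.summable_norm_exp hx).of_norm.tsum_eq_zero_add]
  simp

theorem pExp_add (hx : ‖x‖ < r) (hy : ‖y‖ < r) :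
    pExp (x + y) = pExp x * pExp y := by
  have := hr.charZero ((norm_nonneg x).trans_lt hx)
  rw [pExp, pExp, pExp, tsum_mul_tsum_eq_tsum_sum_antidiagonal_of_summable_norm
    (hr.summable_norm_exp hx) (hr.summable_norm_exp hy)]
  refine tsum_congr fun n => ?_
  rw [(Commute.all x y).add_pow', Finset.sum_div]
  refine Finset.sum_congr rfl fun kl hkl => ?_
  obtain rfl := Finset.HasAntidiagonal.mem_antidiagonal.mp hkl
  have h1 : (kl.1.factorial : F) ≠ 0 := by exact_mod_cast Nat.factorial_ne_zero _
  have h2 : (kl.2.factorial : F) ≠ 0 := by exact_mod_cast Nat.factorial_ne_zero _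
  have h3 : ((kl.1 + kl.2).factorial : F) ≠ 0 := by exact_mod_cast Nat.factorial_ne_zero _
  have h4 : ((kl.1 + kl.2).choose kl.1 : F) * kl.1.factorial * kl.2.factorial =
      (kl.1 + kl.2).factorial := by
    rw [Nat.choose_symm_add]
    exact_mod_cast Nat.add_choose_mul_factorial_mul_factorial kl.1 kl.2
  rw [nsmul_eq_mul]
  field_simp
  rw [← h4]
  ring

variable [IsUltrametricDist F]

theorem pExp_natCast_mul (hx : ‖x‖ < r) (n : ℕ) : pExp ((n : F) * x) = pExp x ^ n := by
  induction n with
  | zero =>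
    rw [hr.pExp_eq (by simpa using (norm_nonneg x).trans_lt hx)]
    simp
  | succ n ih =>
    rw [Nat.cast_succ, add_one_mul, hr.pExp_add ((norm_natCast_mul_le x n).trans_lt hx) hx, ih,
      pow_succ]

theorem norm_pExp_sub_one_le (hx : ‖x‖ < r) : ‖pExp x - 1‖ ≤ ‖x‖ := by
  rw [hr.pExp_eq hx, add_sub_cancel_left]
  exact IsUltrametricDist.norm_tsum_le_of_forall_le_of_nonneg (norm_nonneg x) fun n =>
    (hr.norm_div_factorial_le hx n).trans (norm_mul_geometric_le hx n)

theorem summable_log (hx : ‖x‖ < r) :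
    Summable fun n : ℕ => (-1 : F) ^ (n + 1) * x ^ n / (n : F) := by
  rw [← summable_nat_add_iff 1]
  refine Summable.of_norm_bounded (summable_norm_mul_geometric hx) fun n => ?_
  rw [mul_div_assoc, norm_mul, norm_pow, norm_neg, norm_one, one_pow, one_mul]
  exact hr.norm_div_succ_le hx n

theorem pLog_eq (hx : ‖x‖ < r) :
    pLog x = ∑' n : ℕ, (-1 : F) ^ n * (x ^ (n + 1) / ((n + 1 : ℕ) : F)) := by
  rw [pLog, (hr.summable_log hx).tsum_eq_zero_add]
  simp [pow_succ, mul_div_assoc]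

theorem norm_pLog (hx : ‖x‖ < r) : ‖pLog x‖ = ‖x‖ := by
  have h0 : 0 < r := (norm_nonneg x).trans_lt hx
  rcases eq_or_ne x 0 with rfl | hne
  · rw [hr.pLog_eq hx]
    simp
  have hpos : 0 < ‖x‖ := norm_pos_iff.2 hne
  have hsum := (summable_nat_add_iff 1).2 (hr.summable_log hx)
  have hrest : ‖pLog x - x‖ ≤ ‖x‖ * (‖x‖ / r) := by
    have hsplit : pLog x - x =
        ∑' n : ℕ, (-1 : F) ^ (n + 1) * (x ^ (n + 1 + 1) / ((n + 1 + 1 : ℕ) : F)) := by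
      rw [hr.pLog_eq hx, Summable.tsum_eq_zero_add]
      · simp
      · simpa [pow_succ, mul_div_assoc] using hsum
    rw [hsplit]
    refine IsUltrametricDist.norm_tsum_le_of_forall_le_of_nonneg (by positivity) fun n => ?_
    rw [norm_mul, norm_pow, norm_neg, norm_one, one_pow, one_mul]
    refine (hr.norm_div_succ_le hx (n + 1)).trans ?_
    refine mul_le_mul_of_nonneg_left ?_ hpos.le
    exact pow_le_of_le_one (by positivity) ((div_lt_one h0).2 hx).le n.succ_ne_zero
  have hlt : ‖pLog x - x‖ < ‖x‖ :=
    hrest.trans_lt (mul_lt_of_lt_one_right hpos ((div_lt_one h0).2 hx))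
  have := IsUltrametricDist.norm_add_eq_max_of_norm_ne_norm hlt.ne
  rwa [sub_add_cancel, max_eq_right hlt.le] at this

end FactorialBound

theorem one_add_pow_sub_one_div [CharZero F] (x : F) (m : ℕ) :
    ((1 + x) ^ (m + 1) - 1) / ((m + 1 : ℕ) : F) =
      ∑' k : ℕ, (m.choose k : F) * (x ^ (k + 1) / ((k + 1 : ℕ) : F)) := by
  rw [tsum_eq_sum (s := Finset.range (m + 1)), add_comm 1 x, add_pow, Finset.sum_range_succ']
  · simp only [one_pow, mul_one, pow_zero, Nat.choose_zero_right, Nat.cast_one,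
      add_sub_cancel_right, Finset.sum_div]
    refine Finset.sum_congr rfl fun k _ => ?_
    have h : ((m + 1 : ℕ) : F) * (m.choose k : F) =
        ((m + 1).choose (k + 1) : F) * ((k + 1 : ℕ) : F) := by
      exact_mod_cast Nat.add_one_mul_choose_eq m k
    have h1 : ((m + 1 : ℕ) : F) ≠ 0 := by exact_mod_cast m.succ_ne_zero
    have h2 : ((k + 1 : ℕ) : F) ≠ 0 := by exact_mod_cast k.succ_ne_zero
    field_simp
    linear_combination (-(x ^ (k + 1)) : F) * h
  · intro k hk
    rw [Nat.choose_eq_zero_of_lt (by simpa using hk)]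
    simp

theorem tendsto_choose_neg_one_pow [CharZero F] [IsUltrametricDist F] {m : ℕ → ℕ}
    (hm : Tendsto (fun n => ((m n + 1 : ℕ) : F)) atTop (𝓝 0)) (k : ℕ) :
    Tendsto (fun n => ((m n).choose k : F)) atTop (𝓝 ((-1) ^ k)) := by
  induction k with
  | zero => simp
  | succ k ih =>
    have hprod : Tendsto (fun n => ((m n + 1 : ℕ) : F) * ((m n).choose k : F) / ((k + 1 : ℕ) : F))
        atTop (𝓝 0) := by
      simpa using (hm.mul ih).div_const ((k + 1 : ℕ) : F)
    have h := hprod.sub ih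
    rw [zero_sub, ← neg_one_mul, ← pow_succ'] at h
    refine h.congr fun n => ?_
    have h2 : ((k + 1 : ℕ) : F) ≠ 0 := by exact_mod_cast k.succ_ne_zero
    have h3 : ((m n + 1 : ℕ) : F) * ((m n).choose k : F) =
        ((m n).choose k + (m n).choose (k + 1) : F) * ((k + 1 : ℕ) : F) := by
      exact_mod_cast Nat.add_one_mul_choose_eq (m n) k
    rw [h3, mul_div_cancel_right₀ _ h2, add_sub_cancel_left]

namespace FactorialBound

variable [CompleteSpace F] [IsUltrametricDist F] {r : ℝ} (hr : FactorialBound F r) {x y : F}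
  {m : ℕ → ℕ} (hm : Tendsto (fun n => ((m n + 1 : ℕ) : F)) atTop (𝓝 0))
include hr hm

theorem tendsto_one_add_pow_sub_one_div (hx : ‖x‖ < r) :
    Tendsto (fun n => ((1 + x) ^ (m n + 1) - 1) / ((m n + 1 : ℕ) : F)) atTop (𝓝 (pLog x)) := by
  have := hr.charZero ((norm_nonneg x).trans_lt hx)
  simp only [one_add_pow_sub_one_div]
  rw [hr.pLog_eq hx]
  refine tendsto_tsum_of_dominated_convergence (summable_norm_mul_geometric hx)
    (fun k => (tendsto_choose_neg_one_pow hm k).mul_const _) (Eventually.of_forall fun n k => ?_)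
  exact (norm_natCast_mul_le _ _).trans (hr.norm_div_succ_le hx k)

theorem tendsto_pExp_natCast_mul_sub_one_div (hx : ‖x‖ < r) :
    Tendsto (fun n => (pExp (((m n + 1 : ℕ) : F) * x) - 1) / ((m n + 1 : ℕ) : F)) atTop
      (𝓝 x) := by
  have := hr.charZero ((norm_nonneg x).trans_lt hx)
  have hseries (n : ℕ) : (pExp (((m n + 1 : ℕ) : F) * x) - 1) / ((m n + 1 : ℕ) : F) =
      ∑' k : ℕ, ((m n + 1 : ℕ) : F) ^ k * (x ^ (k + 1) / ((k + 1).factorial : F)) := by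
    rw [hr.pExp_eq ((norm_natCast_mul_le x _).trans_lt hx), add_sub_cancel_left, ← tsum_div_const]
    refine tsum_congr fun k => ?_
    have h1 : ((m n + 1 : ℕ) : F) ≠ 0 := by exact_mod_cast (m n).succ_ne_zero
    rw [mul_pow, pow_succ]
    field_simp
  simp only [hseries]
  have hlim : ∑' k : ℕ, (0 : F) ^ k * (x ^ (k + 1) / ((k + 1).factorial : F)) = x := by
    rw [tsum_eq_single 0 fun k hk => by simp [hk]]
    simp
  conv => enter [3, 1]; rw [← hlim]
  refine tendsto_tsum_of_dominated_convergence (summable_norm_mul_geometric hx)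
    (fun k => (hm.pow k).mul_const _) (Eventually.of_forall fun n k => ?_)
  rw [← Nat.cast_pow]
  exact (norm_natCast_mul_le _ _).trans (hr.norm_div_factorial_le hx k)

theorem pLog_pExp_sub_one (hx : ‖x‖ < r) : pLog (pExp x - 1) = x := by
  refine tendsto_nhds_unique (hr.tendsto_one_add_pow_sub_one_div hm
    ((hr.norm_pExp_sub_one_le hx).trans_lt hx)) ?_
  simpa only [add_sub_cancel, hr.pExp_natCast_mul hx] using
    hr.tendsto_pExp_natCast_mul_sub_one_div hm hx

theorem pLog_add_add_mul (hx : ‖x‖ < r) (hy : ‖y‖ < r) :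
    pLog (x + y + x * y) = pLog x + pLog y := by
  have := hr.charZero ((norm_nonneg x).trans_lt hx)
  have hxy : ‖x + y + x * y‖ < r := by
    refine (IsUltrametricDist.norm_add_le_max _ _).trans_lt (max_lt ?_ (hr.norm_mul_lt hx hy))
    exact (IsUltrametricDist.norm_add_le_max _ _).trans_lt (max_lt hx hy)
  refine tendsto_nhds_unique (hr.tendsto_one_add_pow_sub_one_div hm hxy) ?_
  have hx' := hr.tendsto_one_add_pow_sub_one_div hm hx
  have hy' := hr.tendsto_one_add_pow_sub_one_div hm hy
  have h := (hx'.add hy').add (hm.mul (hx'.mul hy'))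
  rw [zero_mul, add_zero] at h
  refine h.congr fun n => ?_
  have h1 : ((m n + 1 : ℕ) : F) ≠ 0 := by exact_mod_cast (m n).succ_ne_zero
  have h2 : 1 + (x + y + x * y) = (1 + x) * (1 + y) := by ring
  rw [h2, mul_pow]
  field_simp
  ring

theorem eq_of_pLog_eq (hx : ‖x‖ < r) (hy : ‖y‖ < r) (h : pLog x = pLog y) : x = y := by
  have h1 := hr.le_one
  have hunit : ‖1 + y‖ = 1 := by
    have hne : ‖(1 : F)‖ ≠ ‖y‖ := by
      rw [norm_one]
      exact (hy.trans_le h1).ne'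
    rw [IsUltrametricDist.norm_add_eq_max_of_norm_ne_norm hne, norm_one,
      max_eq_left (hy.le.trans h1)]
  have hne : 1 + y ≠ 0 := by
    rw [← norm_pos_iff, hunit]
    exact one_pos
  have hz : ‖(x - y) / (1 + y)‖ < r := by
    rw [norm_div, hunit, div_one]
    rw [sub_eq_add_neg]
    exact (IsUltrametricDist.norm_add_le_max _ _).trans_lt (max_lt hx ((norm_neg y).trans_lt hy))
  have hmul := hr.pLog_add_add_mul hm hy hz
  have hxy : y + (x - y) / (1 + y) + y * ((x - y) / (1 + y)) = x := by
    field_simp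
    ring
  rw [hxy, h, left_eq_add, ← norm_eq_zero, hr.norm_pLog hz, norm_eq_zero, div_eq_zero_iff] at hmul
  exact sub_eq_zero.1 (hmul.resolve_right hne)

theorem pExp_pLog (hx : ‖x‖ < r) : pExp (pLog x) = 1 + x := by
  have hlog : ‖pLog x‖ < r := (hr.norm_pLog hx).trans_lt hx
  have h := hr.eq_of_pLog_eq hm ((hr.norm_pExp_sub_one_le hlog).trans_lt hlog) hx
    (hr.pLog_pExp_sub_one hm hlog)
  rwa [sub_eq_iff_eq_add'] at h

end FactorialBound

end PadicExponentialLogarithm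

/-- Let `F` be a field complete with respect to a nonarchimedean absolute value
extending the `p`-adic absolute value, and `𝔪' = {x : |x| < |p|^{1/(p−1)}}`. The logarithm
series converges on `𝔪'`, defines a group homomorphism `1 + 𝔪' → (F,+)` (i.e.
`log((1+x)(1+y)) = log(1+x) + log(1+y)`), is injective there, and is inverse to the
exponential series `exp`, which also converges on this region. -/
theorem stmt8 (p : ℕ) [Fact p.Prime] (F : Type*) [NontriviallyNormedField F]
    [CompleteSpace F] [IsUltrametricDist F]
    (hnorm : ∀ q : ℚ, ‖(q : F)‖ = ‖(q : ℚ_[p])‖)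
    (x y : F)
    (hx : ‖x‖ < ‖(p : F)‖ ^ ((1 : ℝ) / ((p : ℝ) - 1)))
    (hy : ‖y‖ < ‖(p : F)‖ ^ ((1 : ℝ) / ((p : ℝ) - 1))) :
    Summable (fun n : ℕ => (-1 : F) ^ (n + 1) * x ^ n / (n : F)) ∧
    Summable (fun n : ℕ => x ^ n / (n.factorial : F)) ∧
    pLog (x + y + x * y) = pLog x + pLog y ∧
    pExp (pLog x) = 1 + x ∧
    pLog (pExp x - 1) = x ∧
    (pLog x = pLog y → x = y) := by
  have hp : p.Prime := Fact.out
  have hr := factorialBound_of_norm_ratCast hnorm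
  have hm : Tendsto (fun n => ((p ^ n - 1 + 1 : ℕ) : F)) atTop (𝓝 0) := by
    simp only [Nat.sub_add_cancel (Nat.one_le_pow _ _ hp.pos), Nat.cast_pow]
    refine tendsto_pow_atTop_nhds_zero_of_norm_lt_one ?_
    have h : ‖(p : F)‖ = ‖(p : ℚ_[p])‖ := by simpa using hnorm p
    exact h.trans_lt Padic.norm_p_lt_one
  exact ⟨hr.summable_log hx, (hr.summable_norm_exp hx).of_norm, hr.pLog_add_add_mul hm hx hy,
    hr.pExp_pLog hm hx, hr.pLog_pExp_sub_one hm hx, hr.eq_of_pLog_eq hm hx hy⟩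

end
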